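/- Let A=(C,m) be a 3-dimensional toric idealistic cluster with nodes Q_1,…,Q_r, and let Q_j be a node with χ_j > 0. Write ν_j/N_j = a/b with a, b coprime positive integers. Then Σ_{i: 1 ≤ i ≤ r, b | N_i} χ_i > 0. (Via A'Campo's formula this says that e^{−2πi·ν_j/N_j} is an eigenvalue of the local monodromy at the origin of a surface general for the cluster.) -/

import Mathlib

open Finset

/-!
Common framework: 3-dimensional toric constellations and toric idealistic clusters.
The edge labels `1, 2, 3` of the paper are encoded as `0, 1, 2 : Fin 3`.
-/

/-- A 3-dimensional toric constellation: a finite rooted tree on nodes `0, …, r−1`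
(node `0` the root, every child having larger index than its parent), each node having
at most three children, the edges from a node to its children carrying pairwise
distinct labels in `Fin 3`.  `label j` is the label of the edge from `parent j` to `j`
(irrelevant for the root). -/
structure ToricConstellation (r : ℕ) where
  parent : Fin r → Fin r
  label : Fin r → Fin 3
  parent_lt : ∀ i : Fin r, 0 < (i : ℕ) → (parent i : ℕ) < (i : ℕ)
  parent_root : ∀ i : Fin r, (i : ℕ) = 0 → parent i = i
  label_distinct : ∀ i j : Fin r, 0 < (i : ℕ) → 0 < (j : ℕ) → i ≠ j →
    parent i = parent j → label i ≠ label j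

namespace ToricConstellation

variable {r : ℕ}

/-- The ordered triple of vectors of `ℤ³` attached to a node: the root carries the
standard basis, and the child along the edge labelled `a` of a node with cone
`(u₁,u₂,u₃)` carries the triple obtained by replacing `u_a` with `u₁+u₂+u₃`. -/
def cone (C : ToricConstellation r) (i : Fin r) : Fin 3 → (Fin 3 → ℤ) :=
  if h : 0 < (i : ℕ) then
    Function.update (cone C (C.parent i)) (C.label i) (∑ a, cone C (C.parent i) a)
  else fun a => Pi.single a 1
termination_by (i : ℕ)
decreasing_by all_goals exact C.parent_lt i h

/-- `v(Q) = u₁ + u₂ + u₃`, the sum of the cone vectors of a node. -/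
def v (C : ToricConstellation r) (i : Fin r) : Fin 3 → ℤ := ∑ a, cone C i a

/-- `Prox C j i` means `j → i`, i.e. `Q_j` is proximate to `Q_i`:
`j ≠ i` and `v(Q_i)` is an entry of `cone(Q_j)`. -/
def Prox (C : ToricConstellation r) (j i : Fin r) : Prop :=
  j ≠ i ∧ ∃ a : Fin 3, cone C j a = v C i

instance (C : ToricConstellation r) (j i : Fin r) : Decidable (C.Prox j i) := by
  unfold Prox; infer_instance

/-- `inChain C i a b j = true` iff `j = Q_i(a, b^t)` for some `t ≥ 0`, i.e. `j` is
reached from `i` by one edge labelled `a` followed by `t` edges labelled `b`. -/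
def inChain (C : ToricConstellation r) (i : Fin r) (a b : Fin 3) (j : Fin r) : Bool :=
  if h : 0 < (j : ℕ) then
    (decide (C.parent j = i) && decide (C.label j = a)) ||
      (decide (C.label j = b) && inChain C i a b (C.parent j))
  else false
termination_by (j : ℕ)
decreasing_by exact C.parent_lt j h

/-- `LinProx C j i` means `j ↠ i`, i.e. `Q_j` is linearly proximate to `Q_i`. -/
def LinProx (C : ToricConstellation r) (j i : Fin r) : Prop :=
  ∃ a b : Fin 3, a ≠ b ∧ inChain C i a b j = true

instance (C : ToricConstellation r) (j i : Fin r) : Decidable (C.LinProx j i) := by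
  unfold LinProx; infer_instance

/-- `j` is a child of `i`. -/
def IsChild (C : ToricConstellation r) (j i : Fin r) : Prop :=
  0 < (j : ℕ) ∧ C.parent j = i

instance (C : ToricConstellation r) (j i : Fin r) : Decidable (C.IsChild j i) := by
  unfold IsChild; infer_instance

/-- The set `S_i` of labels of the edges on the path from the root to `Q_i`. -/
def labelsUnder (C : ToricConstellation r) (i : Fin r) : Finset (Fin 3) :=
  if h : 0 < (i : ℕ) then insert (C.label i) (labelsUnder C (C.parent i)) else ∅
termination_by (i : ℕ)
decreasing_by exact C.parent_lt i h

/-- `i` is a weak ancestor of `j` (`i = j` or `i` a strict ancestor of `j`). -/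
def anc (C : ToricConstellation r) (i j : Fin r) : Bool :=
  decide (i = j) || (if h : 0 < (j : ℕ) then anc C i (C.parent j) else false)
termination_by (j : ℕ)
decreasing_by exact C.parent_lt j h

/-- The set of nodes weakly above `i` (`i` together with its descendants). -/
def weakAbove (C : ToricConstellation r) (i : Fin r) : Finset (Fin r) :=
  univ.filter (fun j => anc C i j = true)

end ToricConstellation

/-- A 3-dimensional toric cluster: a toric constellation together with a positive
integer weight for each node. -/
structure ToricCluster (r : ℕ) extends ToricConstellation r where
  m : Fin r → ℤ
  m_pos : ∀ j, 0 < m j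

namespace ToricCluster

open ToricConstellation

variable {r : ℕ}

/-- `M_{Q_i}(a,b) := Σ_{t ≥ 0, Q_i(a,b^t) ∈ C} m_{Q_i(a,b^t)}`. -/
def M (A : ToricCluster r) (i : Fin r) (a b : Fin 3) : ℤ :=
  ∑ j ∈ univ.filter (fun j => inChain A.toToricConstellation i a b j = true), A.m j

/-- The cluster is idealistic: the linear proximity inequalities
`M_{Q_i}(a,b) + M_{Q_i}(b,a) ≤ m_{Q_i}` hold. -/
def Idealistic (A : ToricCluster r) : Prop :=
  ∀ i : Fin r, ∀ a b : Fin 3, a ≠ b → A.M i a b + A.M i b a ≤ A.m i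

/-- The set of nodes `j` proximate to `i` (`j → i`). -/
def proxSet (A : ToricCluster r) (i : Fin r) : Finset (Fin r) :=
  univ.filter (fun j => Prox A.toToricConstellation j i)

/-- `B_i`: the set of nodes to which `i` is proximate. -/
def Bset (A : ToricCluster r) (i : Fin r) : Finset (Fin r) :=
  univ.filter (fun j => Prox A.toToricConstellation i j)

/-- `A_i`: the children `k` of `i` for which there is no `l` with `i → l` and `k → l`. -/
def Aset (A : ToricCluster r) (i : Fin r) : Finset (Fin r) :=
  univ.filter (fun k => IsChild A.toToricConstellation k i ∧
    ¬ ∃ l, Prox A.toToricConstellation i l ∧ Prox A.toToricConstellation k l)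

/-- The Euler characteristic `χ_i = χ(E_i°)`. -/
def chi (A : ToricCluster r) (i : Fin r) : ℤ :=
  3 + A.m i * (A.m i - 3)
    - ∑ j ∈ A.proxSet i, A.m j * (A.m j - 1)
    + ∑ j ∈ A.proxSet i,
        (A.m j - ∑ k ∈ (A.proxSet i).filter
          (fun k => LinProx A.toToricConstellation k j), A.m k)
    + ∑ j ∈ A.Bset i,
        (A.m i - ∑ k ∈ (A.proxSet j).filter
          (fun k => LinProx A.toToricConstellation k i), A.m k)
    - ((A.Aset i).card : ℤ) - 2 * ((A.Bset i).card : ℤ)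
    + (((A.Bset i).card.choose 2 : ℕ) : ℤ)

/-- `D_i = m_i² − Σ_{j→i} m_j²`. -/
def D (A : ToricCluster r) (i : Fin r) : ℤ :=
  A.m i ^ 2 - ∑ j ∈ A.proxSet i, A.m j ^ 2

/-- `r_{ab} = m_i − M_{Q_i}(a,b) − M_{Q_i}(b,a)`. -/
def rab (A : ToricCluster r) (i : Fin r) (a b : Fin 3) : ℤ :=
  A.m i - A.M i a b - A.M i b a

/-- `R_i = r̂_{12} + r̂_{13} + r̂_{23}`, where `r̂_{ab} = r_{ab}` if the remaining third
label does not appear under `Q_i`, and `r̂_{ab} = 0` otherwise.  (Labels `1,2,3` are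
encoded as `0,1,2 : Fin 3`.) -/
def R (A : ToricCluster r) (i : Fin r) : ℤ :=
  (if (2 : Fin 3) ∉ labelsUnder A.toToricConstellation i then A.rab i 0 1 else 0)
  + (if (1 : Fin 3) ∉ labelsUnder A.toToricConstellation i then A.rab i 0 2 else 0)
  + (if (0 : Fin 3) ∉ labelsUnder A.toToricConstellation i then A.rab i 1 2 else 0)

/-- `T_i = 3 − #A_i − 2·#B_i + (#B_i choose 2)`. -/
def T (A : ToricCluster r) (i : Fin r) : ℤ :=
  3 - ((A.Aset i).card : ℤ) - 2 * ((A.Bset i).card : ℤ)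
    + (((A.Bset i).card.choose 2 : ℕ) : ℤ)

/-- The nodes to which `i` is proximate, of smaller index: the sums in the recursive
definitions of the numerical data range over the nodes to which `i` is proximate,
which are ancestors of `i` and hence have smaller index (making the recursion
well-founded). -/
def anteSet (A : ToricCluster r) (i : Fin r) : Finset (Fin r) :=
  univ.filter (fun j => (j : ℕ) < (i : ℕ) ∧ Prox A.toToricConstellation i j)

/-- The numerical datum `N_i := m_i + Σ_{j : i→j} N_j`. -/
def N (A : ToricCluster r) (i : Fin r) : ℤ :=
  A.m i + ∑ j ∈ (A.anteSet i).attach, N A j.1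
termination_by (i : ℕ)
decreasing_by
  have hj := j.2
  simp only [anteSet, Finset.mem_filter] at hj
  exact hj.2.1

/-- The numerical datum `ν_i := 3 + Σ_{j : i→j} (ν_j − 1)`. -/
def nu (A : ToricCluster r) (i : Fin r) : ℤ :=
  3 + ∑ j ∈ (A.anteSet i).attach, (nu A j.1 - 1)
termination_by (i : ℕ)
decreasing_by
  have hj := j.2
  simp only [anteSet, Finset.mem_filter] at hj
  exact hj.2.1

end ToricCluster

namespace ToricConstellation

variable {r : ℕ}

/-- The linear map sending `e_a` to `(1,1,1)` and fixing the other basis vectors. -/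
def blowAct (a : Fin 3) (x : Fin 3 → ℤ) : Fin 3 → ℤ :=
  fun d => if d = a then x a else x a + x d

/-- The labels of the edges on the path from the root to a node. -/
def path (C : ToricConstellation r) (i : Fin r) : List (Fin 3) :=
  if h : 0 < (i : ℕ) then path C (C.parent i) ++ [C.label i] else []
termination_by (i : ℕ)
decreasing_by exact C.parent_lt i h

theorem add_one_ne_self : ∀ a : Fin 3, a + 1 ≠ a := by decide

theorem blowAct_injective (a : Fin 3) : Function.Injective (blowAct a) := by
  intro x y h
  have ha : x a = y a := by simpa [blowAct] using congrFun h a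
  funext d
  have hd := congrFun h d
  by_cases hda : d = a
  · rw [hda, ha]
  · simpa [blowAct, hda, ha] using hd

theorem blowAct_single_self (a : Fin 3) : blowAct a (Pi.single a 1) = 1 := by
  funext d
  by_cases hda : d = a <;> simp [blowAct, hda]

theorem blowAct_single_ne {a d : Fin 3} (h : d ≠ a) :
    blowAct a (Pi.single d 1) = Pi.single d 1 := by
  funext e
  by_cases hea : e = a
  · subst hea; simp [blowAct]
  · simp [blowAct, hea, Ne.symm h]

theorem foldr_blowAct_add (w : List (Fin 3)) (x y : Fin 3 → ℤ) :
    w.foldr blowAct (x + y) = w.foldr blowAct x + w.foldr blowAct y := by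
  induction w with
  | nil => rfl
  | cons a w ih =>
    simp only [List.foldr_cons, ih]
    funext d
    by_cases h : d = a
    · simp [blowAct, h]
    · simp only [blowAct, h, if_false, Pi.add_apply]; ring

theorem foldr_blowAct_injective (w : List (Fin 3)) :
    Function.Injective (fun x => w.foldr blowAct x) := by
  induction w with
  | nil => exact fun _ _ h => h
  | cons a w ih => exact fun x y h => ih (blowAct_injective a h)

theorem foldr_blowAct_one_pos (w : List (Fin 3)) (d : Fin 3) :
    0 < w.foldr blowAct 1 d := by
  induction w generalizing d with
  | nil => simp
  | cons a w ih =>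
    have h1 := ih a
    have h2 := ih d
    simp only [List.foldr_cons, blowAct]
    split_ifs <;> linarith

theorem foldr_blowAct_one_injective :
    Function.Injective (fun w : List (Fin 3) => w.foldr blowAct 1) := by
  have key : ∀ (a : Fin 3) (w : List (Fin 3)) (d : Fin 3), d ≠ a →
      (a :: w).foldr blowAct 1 a < (a :: w).foldr blowAct 1 d := by
    intro a w d h
    have := foldr_blowAct_one_pos w d
    simp [blowAct, h, this]
  intro w
  induction w with
  | nil =>
    intro w' h
    cases w' with
    | nil => rfl
    | cons a w' =>
      exfalso
      have h1 := key a w' (a + 1) (add_one_ne_self a)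
      have h' : (1 : Fin 3 → ℤ) = (a :: w').foldr blowAct 1 := h
      rw [← h'] at h1
      simp at h1
  | cons a w ih =>
    intro w' h
    cases w' with
    | nil =>
      exfalso
      have h1 := key a w (a + 1) (add_one_ne_self a)
      have h' : (a :: w).foldr blowAct 1 = (1 : Fin 3 → ℤ) := h
      rw [h'] at h1
      simp at h1
    | cons a' w' =>
      have h' : (a :: w).foldr blowAct 1 = (a' :: w').foldr blowAct 1 := h
      have haa : a = a' := by
        by_contra hne
        have h1 := key a w a' (Ne.symm hne)
        have h2 := key a' w' a hne
        rw [h'] at h1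
        exact lt_asymm h1 h2
      subst haa
      rw [ih (blowAct_injective a h')]

theorem path_injective (C : ToricConstellation r) : Function.Injective C.path := by
  intro k
  induction hn : (k : ℕ) using Nat.strong_induction_on generalizing k with
  | _ n ih =>
    intro l h
    subst hn
    rw [path, path.eq_def C l] at h
    by_cases hk : 0 < (k : ℕ) <;> by_cases hl : 0 < (l : ℕ)
    · rw [dif_pos hk, dif_pos hl] at h
      obtain ⟨h1, h2⟩ := List.append_inj' h rfl
      have hp := ih _ (C.parent_lt k hk) rfl h1
      by_contra hne
      exact C.label_distinct k l hk hl hne hp (by simpa using h2)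
    · simp [hk, hl] at h
    · simp [hk, hl] at h
    · exact Fin.ext (by omega)

theorem cone_eq_foldr (C : ToricConstellation r) (k : Fin r) (d : Fin 3) :
    C.cone k d = (C.path k).foldr blowAct (Pi.single d 1) := by
  induction hn : (k : ℕ) using Nat.strong_induction_on generalizing k d with
  | _ n ih =>
    subst hn
    rw [cone, path]
    by_cases hk : 0 < (k : ℕ)
    · rw [dif_pos hk, dif_pos hk]
      have hp := fun d => ih _ (C.parent_lt k hk) (C.parent k) d rfl
      by_cases hd : d = C.label k
      · subst hd
        simp only [Function.update_self, List.foldr_append, List.foldr_cons, List.foldr_nil,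
          blowAct_single_self, hp]
        rw [Fin.sum_univ_three, ← foldr_blowAct_add, ← foldr_blowAct_add]
        congr 1
        funext e
        fin_cases e <;> simp
      · simp only [Function.update_of_ne hd, List.foldr_append, List.foldr_cons, List.foldr_nil,
          blowAct_single_ne hd, hp]
    · rw [dif_neg hk, dif_neg hk]; rfl

theorem v_eq_foldr (C : ToricConstellation r) (k : Fin r) :
    C.v k = (C.path k).foldr blowAct 1 := by
  simp only [v, cone_eq_foldr]
  rw [Fin.sum_univ_three, ← foldr_blowAct_add, ← foldr_blowAct_add]
  congr 1
  funext e
  fin_cases e <;> simp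

theorem v_injective (C : ToricConstellation r) : Function.Injective C.v := by
  intro k l h
  rw [v_eq_foldr, v_eq_foldr] at h
  exact C.path_injective (foldr_blowAct_one_injective h)

theorem cone_injective (C : ToricConstellation r) (k : Fin r) :
    Function.Injective (C.cone k) := by
  intro d e h
  rw [cone_eq_foldr, cone_eq_foldr] at h
  by_contra hne
  have := congrFun (foldr_blowAct_injective _ h) d
  simp [hne] at this

/-- An entry of a cone is the central ray of `i` exactly when it was created by blowing up
`i` and has survived since. -/
theorem cone_eq_v_iff (C : ToricConstellation r) (k i : Fin r) (d : Fin 3) :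
    C.cone k d = C.v i ↔ 0 < (k : ℕ) ∧ ((C.label k = d ∧ C.parent k = i) ∨
      (C.label k ≠ d ∧ C.cone (C.parent k) d = C.v i)) := by
  by_cases hk : 0 < (k : ℕ)
  · rw [cone, dif_pos hk]
    by_cases hd : d = C.label k
    · subst hd
      simp only [Function.update_self, hk, true_and, ne_eq, not_true_eq_false, false_and, or_false]
      exact ⟨fun h => C.v_injective h, fun h => by rw [← h]; rfl⟩
    · rw [Function.update_of_ne hd]
      simp [hk, Ne.symm hd]
  · simp only [hk, false_and, iff_false]
    intro h
    have h1 := foldr_blowAct_one_pos (C.path i) (d + 1)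
    rw [← v_eq_foldr, ← h, cone, dif_neg hk] at h1
    rw [Pi.single_eq_of_ne (add_one_ne_self d)] at h1
    exact lt_irrefl _ h1

theorem lt_of_cone_eq_v (C : ToricConstellation r) {k i : Fin r} {d : Fin 3}
    (h : C.cone k d = C.v i) : (i : ℕ) < k := by
  induction hn : (k : ℕ) using Nat.strong_induction_on generalizing k with
  | _ n ih =>
    subst hn
    obtain ⟨hk, h | h⟩ := (C.cone_eq_v_iff k i d).1 h
    · rw [← h.2]; exact C.parent_lt k hk
    · exact (ih _ (C.parent_lt k hk) h.2 rfl).trans (C.parent_lt k hk)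

theorem prox_iff (C : ToricConstellation r) {k i : Fin r} :
    C.Prox k i ↔ ∃ d, C.cone k d = C.v i :=
  ⟨fun h => h.2, fun h => ⟨by
    rintro rfl
    obtain ⟨d, hd⟩ := h
    exact lt_irrefl _ (C.lt_of_cone_eq_v hd), h⟩⟩

theorem mem_labelsUnder_iff (C : ToricConstellation r) (k : Fin r) (d : Fin 3) :
    d ∈ C.labelsUnder k ↔ ∃ l, C.cone k d = C.v l := by
  induction hn : (k : ℕ) using Nat.strong_induction_on generalizing k with
  | _ n ih =>
    subst hn
    rw [labelsUnder]
    by_cases hk : 0 < (k : ℕ)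
    · rw [dif_pos hk, mem_insert, ih _ (C.parent_lt k hk) _ rfl]
      simp only [C.cone_eq_v_iff k, hk, true_and]
      constructor
      · rintro (h | ⟨l, h⟩)
        · exact ⟨_, Or.inl ⟨h.symm, rfl⟩⟩
        · by_cases hd : C.label k = d
          · exact ⟨_, Or.inl ⟨hd, rfl⟩⟩
          · exact ⟨l, Or.inr ⟨hd, h⟩⟩
      · rintro ⟨l, h | h⟩
        · exact Or.inl h.1.symm
        · exact Or.inr ⟨l, h.2⟩
    · rw [dif_neg hk]
      simp only [C.cone_eq_v_iff k, hk, false_and, exists_false, notMem_empty]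

theorem inChain_iff (C : ToricConstellation r) (i k : Fin r) (a b : Fin 3) :
    C.inChain i a b k = true ↔ 0 < (k : ℕ) ∧ ((C.parent k = i ∧ C.label k = a) ∨
      (C.label k = b ∧ C.inChain i a b (C.parent k) = true)) := by
  rw [inChain]
  by_cases hk : 0 < (k : ℕ) <;> simp [hk]

theorem lt_of_inChain (C : ToricConstellation r) {i k : Fin r} {a b : Fin 3}
    (h : C.inChain i a b k = true) : (i : ℕ) < k := by
  induction hn : (k : ℕ) using Nat.strong_induction_on generalizing k with
  | _ n ih =>
    subst hn
    obtain ⟨hk, h | h⟩ := (C.inChain_iff i k a b).1 h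
    · rw [← h.1]; exact C.parent_lt k hk
    · exact (ih _ (C.parent_lt k hk) h.2 rfl).trans (C.parent_lt k hk)

theorem cone_of_inChain (C : ToricConstellation r) {i k : Fin r} {a b : Fin 3} (hab : a ≠ b)
    (h : C.inChain i a b k = true) : C.cone k a = C.v i := by
  induction hn : (k : ℕ) using Nat.strong_induction_on generalizing k with
  | _ n ih =>
    subst hn
    rw [cone_eq_v_iff]
    obtain ⟨hk, h | h⟩ := (C.inChain_iff i k a b).1 h
    · exact ⟨hk, Or.inl ⟨h.2, h.1⟩⟩
    · exact ⟨hk, Or.inr ⟨by rw [h.1]; exact hab.symm, ih _ (C.parent_lt k hk) h.2 rfl⟩⟩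

theorem cone_eq_v_iff_of_inChain (C : ToricConstellation r) {i k l : Fin r} {a b : Fin 3}
    (h : C.inChain i a b k = true) (hl : (l : ℕ) < i) (d : Fin 3) :
    C.cone k d = C.v l ↔ C.cone i d = C.v l ∧ a ≠ d ∧ (b ≠ d ∨
      (C.parent k = i ∧ C.label k = a)) := by
  induction hn : (k : ℕ) using Nat.strong_induction_on generalizing k with
  | _ n ih =>
    subst hn
    rw [cone_eq_v_iff]
    obtain ⟨hk, h1 | h1⟩ := (C.inChain_iff i k a b).1 h
    · have hli : i ≠ l := by rintro rfl; exact lt_irrefl _ hl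
      rw [h1.1, h1.2]
      simp [hk, hli, and_comm]
    · have hlt := C.lt_of_inChain h1.2
      have hpi : C.parent k ≠ i := fun e => by rw [e] at hlt; exact lt_irrefl _ hlt
      have hpl : C.parent k ≠ l := fun e => by rw [e] at hlt; exact lt_asymm hl hlt
      rw [ih _ (C.parent_lt k hk) h1.2 rfl, h1.1]
      simp only [hk, hpl, hpi, and_false, false_or, true_and, or_false, false_and]
      tauto

end ToricConstellation

namespace ToricConstellation

variable {r : ℕ}

/-- `Reach C F i k`: the node `k` is reached from `i` by following edges with labels in `F`. -/
inductive Reach (C : ToricConstellation r) (F : Finset (Fin 3)) (i : Fin r) : Fin r → Prop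
  | refl : Reach C F i i
  | step (k : Fin r) (hk : 0 < (k : ℕ)) (hl : C.label k ∈ F) (h : Reach C F i (C.parent k)) :
      Reach C F i k

theorem Reach.le {C : ToricConstellation r} {F : Finset (Fin 3)} {i k : Fin r}
    (h : C.Reach F i k) : (i : ℕ) ≤ k := by
  induction h with
  | refl => exact le_rfl
  | step k hk _ _ ih => exact ih.trans (C.parent_lt k hk).le

theorem Reach.eq_of_siblings {C : ToricConstellation r} {F G : Finset (Fin 3)} {k l n : Fin r}
    (hk : 0 < (k : ℕ)) (hl : 0 < (l : ℕ)) (hp : C.parent k = C.parent l)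
    (h1 : C.Reach F k n) (h2 : C.Reach G l n) : k = l := by
  have hkl := C.parent_lt k hk
  have hlk := C.parent_lt l hl
  induction h1 with
  | refl =>
    cases h2 with
    | refl => rfl
    | step _ _ _ h =>
      have := h.le
      rw [hp] at this
      omega
  | step n hn _ h ih =>
    cases h2 with
    | refl =>
      have := h.le
      rw [← hp] at this
      omega
    | step _ _ _ h' => exact ih h'

/-- The set of children along the edge labelled `a`; it has at most one element. -/
def children (C : ToricConstellation r) (i : Fin r) (a : Fin 3) : Finset (Fin r) :=
  univ.filter fun k => 0 < (k : ℕ) ∧ C.parent k = i ∧ C.label k = a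

theorem mem_children {C : ToricConstellation r} {i k : Fin r} {a : Fin 3} :
    k ∈ C.children i a ↔ 0 < (k : ℕ) ∧ C.parent k = i ∧ C.label k = a := by
  simp [children]

theorem children_eq_empty_or_singleton (C : ToricConstellation r) (i : Fin r) (a : Fin 3) :
    C.children i a = ∅ ∨ ∃ k, C.children i a = {k} := by
  rcases (C.children i a).eq_empty_or_nonempty with h | ⟨k, hk⟩
  · exact Or.inl h
  · refine Or.inr ⟨k, Finset.eq_singleton_iff_unique_mem.2 ⟨hk, fun l hl => ?_⟩⟩
    rw [mem_children] at hk hl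
    by_contra hne
    exact C.label_distinct l k hl.1 hk.1 hne (hl.2.1.trans hk.2.1.symm)
      (hl.2.2.trans hk.2.2.symm)

open scoped Classical in
/-- The sum of `g` over the nodes reached from `i` by edges with labels in `F`. -/
noncomputable def reachSum (C : ToricConstellation r) (F : Finset (Fin 3)) (g : Fin r → ℤ)
    (i : Fin r) : ℤ :=
  ∑ k with C.Reach F i k, g k

/-- The sum of `g` over the nodes reached from `i` by one edge labelled `a` followed by edges
with labels in `F`. -/
noncomputable def branchSum (C : ToricConstellation r) (F : Finset (Fin 3)) (g : Fin r → ℤ)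
    (i : Fin r) (a : Fin 3) : ℤ :=
  ∑ k ∈ C.children i a, C.reachSum F g k

open scoped Classical in
theorem sum_eq_branchSum (C : ToricConstellation r) (F : Finset (Fin 3)) (g : Fin r → ℤ)
    (i : Fin r) (a : Fin 3) (s : Finset (Fin r))
    (hs : ∀ k, k ∈ s ↔ ∃ l ∈ C.children i a, C.Reach F l k) :
    ∑ k ∈ s, g k = C.branchSum F g i a := by
  have : s = (C.children i a).biUnion fun l => univ.filter fun k => C.Reach F l k := by
    ext k; simp [hs]
  rw [this, sum_biUnion]
  · rfl
  · intro k hk l hl hne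
    rw [Function.onFun, disjoint_left]
    intro n hn hn'
    simp only [mem_filter, mem_univ, true_and] at hn hn'
    have hk := mem_children.1 hk
    have hl := mem_children.1 hl
    exact hne (hn.eq_of_siblings hk.1 hl.1 (hk.2.1.trans hl.2.1.symm) hn')

theorem reach_iff_exists_child (C : ToricConstellation r) (F : Finset (Fin 3)) (i k : Fin r) :
    C.Reach F i k ↔ k = i ∨ ∃ a ∈ F, ∃ l ∈ C.children i a, C.Reach F l k := by
  constructor
  · intro h
    induction h with
    | refl => exact Or.inl rfl
    | step k hk hl _ ih =>
      refine Or.inr ?_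
      rcases ih with h | ⟨a, ha, l, hl', h⟩
      · exact ⟨_, hl, k, mem_children.2 ⟨hk, h, rfl⟩, Reach.refl⟩
      · exact ⟨a, ha, l, hl', Reach.step k hk hl h⟩
  · rintro (rfl | ⟨a, ha, l, hl, h⟩)
    · exact Reach.refl
    · rw [mem_children] at hl
      induction h with
      | refl =>
        refine Reach.step _ hl.1 (by rw [hl.2.2]; exact ha) ?_
        rw [hl.2.1]; exact Reach.refl
      | step k hk hl' _ ih => exact Reach.step k hk hl' ih

open scoped Classical in
theorem reachSum_eq (C : ToricConstellation r) (F : Finset (Fin 3)) (g : Fin r → ℤ)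
    (i : Fin r) : C.reachSum F g i = g i + ∑ a ∈ F, C.branchSum F g i a := by
  have hs : (univ.filter fun k => C.Reach F i k) =
      insert i (F.biUnion fun a => univ.filter fun k => ∃ l ∈ C.children i a, C.Reach F l k) := by
    ext k
    rw [mem_filter, reach_iff_exists_child]
    simp
  rw [reachSum, hs, sum_insert, sum_biUnion]
  · congr 1
    exact sum_congr rfl fun a _ => C.sum_eq_branchSum F g i a _ (by simp)
  · intro a _ b _ hne
    rw [Function.onFun, disjoint_left]
    intro n hn hn'
    simp only [mem_filter, mem_univ, true_and] at hn hn'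
    obtain ⟨k, hk, h1⟩ := hn
    obtain ⟨l, hl, h2⟩ := hn'
    rw [mem_children] at hk hl
    have := h1.eq_of_siblings hk.1 hl.1 (hk.2.1.trans hl.2.1.symm) h2
    subst this
    exact hne (hk.2.2.symm.trans hl.2.2)
  · simp only [mem_biUnion, mem_filter, mem_univ, true_and, not_exists, not_and]
    intro a _ k hk h
    rw [mem_children] at hk
    have h1 := h.le
    have h2 := C.parent_lt k hk.1
    rw [hk.2.1] at h2
    omega

theorem inChain_iff_exists_child (C : ToricConstellation r) (i k : Fin r) (a b : Fin 3) :
    C.inChain i a b k = true ↔ ∃ l ∈ C.children i a, C.Reach {b} l k := by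
  induction hn : (k : ℕ) using Nat.strong_induction_on generalizing k with
  | _ n ih =>
    subst hn
    rw [inChain_iff]
    constructor
    · rintro ⟨hk, h | h⟩
      · exact ⟨k, mem_children.2 ⟨hk, h⟩, Reach.refl⟩
      · obtain ⟨l, hl, h'⟩ := (ih _ (C.parent_lt k hk) _ rfl).1 h.2
        exact ⟨l, hl, Reach.step k hk (by simp [h.1]) h'⟩
    · rintro ⟨l, hl, h⟩
      cases h with
      | refl => exact ⟨(mem_children.1 hl).1, Or.inl (mem_children.1 hl).2⟩
      | step _ hk hb h =>
        exact ⟨hk, Or.inr ⟨by simpa using hb, (ih _ (C.parent_lt k hk) _ rfl).2 ⟨l, hl, h⟩⟩⟩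

theorem cone_eq_v_iff_exists_child (C : ToricConstellation r) (i k : Fin r) (a : Fin 3) :
    C.cone k a = C.v i ↔ ∃ l ∈ C.children i a, C.Reach {a}ᶜ l k := by
  induction hn : (k : ℕ) using Nat.strong_induction_on generalizing k with
  | _ n ih =>
    subst hn
    rw [cone_eq_v_iff]
    constructor
    · rintro ⟨hk, h | h⟩
      · exact ⟨k, mem_children.2 ⟨hk, h.2, h.1⟩, Reach.refl⟩
      · obtain ⟨l, hl, h'⟩ := (ih _ (C.parent_lt k hk) _ rfl).1 h.2
        exact ⟨l, hl, Reach.step k hk (by simp [h.1]) h'⟩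
    · rintro ⟨l, hl, h⟩
      cases h with
      | refl => exact ⟨(mem_children.1 hl).1, Or.inl (mem_children.1 hl).2.symm⟩
      | step _ hk hb h =>
        exact ⟨hk, Or.inr ⟨by simpa using hb, (ih _ (C.parent_lt k hk) _ rfl).2 ⟨l, hl, h⟩⟩⟩

end ToricConstellation

namespace ToricConstellation

variable {r : ℕ} (C : ToricConstellation r) {i : Fin r} {a : Fin 3} {F : Finset (Fin 3)}
  {g : Fin r → ℤ}

theorem branchSum_of_eq_empty (h : C.children i a = ∅) : C.branchSum F g i a = 0 := by
  simp [branchSum, h]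

theorem branchSum_of_eq_singleton {k : Fin r} (h : C.children i a = {k}) :
    C.branchSum F g i a = C.reachSum F g k := by
  simp [branchSum, h]

theorem branchSum_nonneg (hg : ∀ k, 0 ≤ g k) : 0 ≤ C.branchSum F g i a :=
  sum_nonneg fun _ _ => sum_nonneg fun _ _ => hg _

theorem lt_of_children_eq_singleton {k : Fin r} (h : C.children i a = {k}) :
    (i : ℕ) < k := by
  have hk : k ∈ C.children i a := by simp [h]
  rw [mem_children] at hk
  rw [← hk.2.1]
  exact C.parent_lt k hk.1

/-- Every node admits a proof by induction from its children. -/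
theorem children_induction {P : Fin r → Prop}
    (h : ∀ i, (∀ a k, C.children i a = {k} → P k) → P i) (i : Fin r) : P i := by
  induction hn : r - (i : ℕ) using Nat.strong_induction_on generalizing i with
  | _ n ih =>
    subst hn
    refine h i fun a k hk => ih _ ?_ k rfl
    have := C.lt_of_children_eq_singleton hk
    have := k.isLt
    omega

theorem cone_child_iff {k i l : Fin r} {a d : Fin 3} (hk : k ∈ C.children i a) :
    C.cone k d = C.v l ↔ (d = a ∧ l = i) ∨ (d ≠ a ∧ C.cone i d = C.v l) := by
  rw [mem_children] at hk
  rw [cone_eq_v_iff, hk.2.1, hk.2.2]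
  simp only [hk.1, true_and, eq_comm, ne_eq]

theorem labelsUnder_child {k i : Fin r} {a : Fin 3} (hk : k ∈ C.children i a) :
    C.labelsUnder k = insert a (C.labelsUnder i) := by
  rw [mem_children] at hk
  rw [labelsUnder, dif_pos hk.1, hk.2.1, hk.2.2]

end ToricConstellation

namespace ToricCluster

open ToricConstellation

variable {r : ℕ} (A : ToricCluster r)

theorem M_eq_branchSum (i : Fin r) (a b : Fin 3) :
    A.M i a b = A.branchSum {b} A.m i a :=
  A.sum_eq_branchSum {b} A.m i a _ fun k => by
    rw [mem_filter, A.inChain_iff_exists_child]; simp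

theorem M_nonneg (i : Fin r) (a b : Fin 3) : 0 ≤ A.M i a b := by
  rw [M_eq_branchSum]
  exact A.branchSum_nonneg fun k => (A.m_pos k).le

theorem le_reachSum (F : Finset (Fin 3)) (k : Fin r) : A.m k ≤ A.reachSum F A.m k := by
  rw [A.reachSum_eq]
  have := sum_nonneg fun a (_ : a ∈ F) =>
    A.branchSum_nonneg (i := k) (a := a) (F := F) fun k => (A.m_pos k).le
  linarith

/-- The area of the region cut off at a corner is bounded in terms of its two legs. -/
theorem corner_bound (hA : A.Idealistic) {b c : Fin 3} (hbc : b ≠ c) (k : Fin r) :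
    A.reachSum {b, c} (fun j => A.m j ^ 2) k
      + A.m k * min (A.reachSum {b} A.m k - A.m k) (A.reachSum {c} A.m k - A.m k)
      + (A.reachSum {b} A.m k - A.m k) * (A.reachSum {c} A.m k - A.m k)
      ≤ A.reachSum {b} A.m k * A.reachSum {c} A.m k := by
  induction k using A.children_induction with | _ k ih
  have branch : ∀ a, A.branchSum {b, c} (fun j => A.m j ^ 2) k a
      ≤ A.branchSum {b} A.m k a * A.branchSum {c} A.m k a := by
    intro a
    rcases A.children_eq_empty_or_singleton k a with h | ⟨l, h⟩
    · simp [A.branchSum_of_eq_empty h]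
    · simp only [A.branchSum_of_eq_singleton h]
      have h1 := ih a l h
      have h2 := A.le_reachSum {b} l
      have h3 := A.le_reachSum {c} l
      have h4 : 0 ≤ min (A.reachSum {b} A.m l - A.m l) (A.reachSum {c} A.m l - A.m l) :=
        le_min (by linarith) (by linarith)
      have h5 := mul_nonneg (A.m_pos l).le h4
      have h6 := mul_nonneg (sub_nonneg.2 h2) (sub_nonneg.2 h3)
      linarith
  have hprox := hA k b c hbc
  have hb := branch b
  have hc := branch c
  have hn := A.m_pos k
  have nn : ∀ d a, 0 ≤ A.branchSum {d} A.m k a :=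
    fun d a => A.branchSum_nonneg fun k => (A.m_pos k).le
  have hs := nn c b
  have hs' := nn b c
  have hp := nn b b
  have hp' := nn c c
  rw [A.reachSum_eq, A.reachSum_eq, A.reachSum_eq, sum_pair hbc, sum_singleton, sum_singleton]
  rw [M_eq_branchSum, M_eq_branchSum] at hprox
  set n := A.m k
  set p := A.branchSum {b} A.m k b
  set s := A.branchSum {c} A.m k b
  set s' := A.branchSum {b} A.m k c
  set p' := A.branchSum {c} A.m k c
  simp only [add_sub_cancel_left]
  rcases le_total p p' with h | h
  · rw [min_eq_left h]
    nlinarith [mul_nonneg hs (sub_nonneg.2 h), mul_nonneg (sub_nonneg.2 hprox) (hp.trans h)]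
  · rw [min_eq_right h]
    nlinarith [mul_nonneg hs' (sub_nonneg.2 h), mul_nonneg (sub_nonneg.2 hprox) (hp'.trans h)]

theorem reachSum_slack {b c : Fin 3} (hbc : b ≠ c) (k : Fin r) :
    A.reachSum {b, c} (fun j => A.m j - (A.M j b c + A.M j c b)) k
      = A.reachSum {b} A.m k + A.reachSum {c} A.m k - A.reachSum {b, c} A.m k := by
  induction k using A.children_induction with | _ k ih
  have branch : ∀ a, A.branchSum {b, c} (fun j => A.m j - (A.M j b c + A.M j c b)) k a
      = A.branchSum {b} A.m k a + A.branchSum {c} A.m k a - A.branchSum {b, c} A.m k a := by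
    intro a
    rcases A.children_eq_empty_or_singleton k a with h | ⟨l, h⟩
    · simp [A.branchSum_of_eq_empty h]
    · simpa only [A.branchSum_of_eq_singleton h] using ih a l h
  rw [A.reachSum_eq, A.reachSum_eq, A.reachSum_eq, A.reachSum_eq, sum_pair hbc, sum_pair hbc,
    sum_singleton, sum_singleton, branch, branch, M_eq_branchSum, M_eq_branchSum]
  ring

theorem branchSum_slack {b c : Fin 3} (hbc : b ≠ c) (i : Fin r) (a : Fin 3) :
    A.branchSum {b, c} (fun j => A.m j - (A.M j b c + A.M j c b)) i a
      = A.M i a b + A.M i a c - A.branchSum {b, c} A.m i a := by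
  rw [M_eq_branchSum, M_eq_branchSum]
  rcases A.children_eq_empty_or_singleton i a with h | ⟨l, h⟩
  · simp [A.branchSum_of_eq_empty h]
  · simpa only [A.branchSum_of_eq_singleton h] using A.reachSum_slack hbc l

theorem sum_proxSet (i : Fin r) (g : Fin r → ℤ) :
    ∑ k ∈ A.proxSet i, g k = ∑ a, ∑ k with A.cone k a = A.v i, g k := by
  have : A.proxSet i = univ.biUnion fun a => univ.filter fun k => A.cone k a = A.v i := by
    ext k; simp [proxSet, A.prox_iff]
  rw [this, sum_biUnion]
  intro a _ b _ hne
  rw [Function.onFun, disjoint_left]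
  intro k hk hk'
  simp only [mem_filter, mem_univ, true_and] at hk hk'
  exact hne (A.cone_injective k (hk.trans hk'.symm))

theorem sum_Bset (i : Fin r) (g : Fin r → ℤ) :
    ∑ l ∈ A.Bset i, g l = ∑ a, ∑ l with A.cone i a = A.v l, g l := by
  have : A.Bset i = univ.biUnion fun a => univ.filter fun l => A.cone i a = A.v l := by
    ext k; simp [Bset, A.prox_iff]
  rw [this, sum_biUnion]
  intro a _ b _ hne
  rw [Function.onFun, disjoint_left]
  intro k hk hk'
  simp only [mem_filter, mem_univ, true_and] at hk hk'
  exact hne (A.cone_injective i (hk.trans hk'.symm))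

theorem sum_cone_eq_v (k : Fin r) (d : Fin 3) (x : ℤ) :
    ∑ l : Fin r with A.cone k d = A.v l, x = if d ∈ A.labelsUnder k then x else 0 := by
  by_cases h : d ∈ A.labelsUnder k
  · rw [if_pos h]
    obtain ⟨l, hl⟩ := (A.mem_labelsUnder_iff k d).1 h
    have : (univ.filter fun l => A.cone k d = A.v l) = {l} := by
      ext l'
      simp only [mem_filter, mem_univ, true_and, mem_singleton]
      exact ⟨fun h' => A.v_injective (h'.symm.trans hl), fun h' => h' ▸ hl⟩
    rw [this, sum_singleton]
  · rw [if_neg h]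
    rw [A.mem_labelsUnder_iff, not_exists] at h
    rw [filter_false_of_mem fun l _ => h l, sum_empty]

theorem card_Bset (i : Fin r) : (A.Bset i).card = (A.labelsUnder i).card := by
  have h := A.sum_Bset i fun _ => 1
  simp only [sum_cone_eq_v] at h
  simp only [sum_const, nsmul_eq_mul, mul_one, sum_ite_mem, univ_inter] at h
  exact_mod_cast h

theorem sum_linProx {j l : Fin r} {d b c : Fin 3} (hj : A.cone j d = A.v l)
    (hdb : d ≠ b) (hdc : d ≠ c) (hbc : b ≠ c) :
    ∑ k ∈ (A.proxSet l).filter (fun k => LinProx A.toToricConstellation k j), A.m k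
      = A.M j b c + A.M j c b := by
  have hlj := A.lt_of_cone_eq_v hj
  have key : (A.proxSet l).filter (fun k => LinProx A.toToricConstellation k j) =
      univ.filter (fun k => A.inChain j b c k = true)
        ∪ univ.filter (fun k => A.inChain j c b k = true) := by
    ext k
    simp only [proxSet, mem_filter, mem_univ, true_and, mem_union, A.prox_iff]
    constructor
    · rintro ⟨⟨e, he⟩, x, y, hxy, hk⟩
      obtain ⟨h1, h2, h3⟩ := (A.cone_eq_v_iff_of_inChain hk hlj e).1 he
      have := A.cone_injective j (h1.trans hj.symm)
      subst this
      rcases h3 with h3 | h3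
      · have : (x = b ∧ y = c) ∨ (x = c ∧ y = b) := by
          clear * - hdb hdc hbc hxy h2 h3
          revert e b c x y
          decide
        rcases this with ⟨rfl, rfl⟩ | ⟨rfl, rfl⟩
        · exact Or.inl hk
        · exact Or.inr hk
      · have hk0 := ((A.inChain_iff j k x y).1 hk).1
        have : x = b ∨ x = c := by
          clear * - hdb hdc hbc h2
          revert e b c x
          decide
        rcases this with rfl | rfl
        · exact Or.inl ((A.inChain_iff j k _ _).2 ⟨hk0, Or.inl h3⟩)
        · exact Or.inr ((A.inChain_iff j k _ _).2 ⟨hk0, Or.inl h3⟩)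
    · rintro (hk | hk)
      · exact ⟨⟨d, (A.cone_eq_v_iff_of_inChain hk hlj d).2 ⟨hj, hdb.symm, Or.inl hdc.symm⟩⟩,
          b, c, hbc, hk⟩
      · exact ⟨⟨d, (A.cone_eq_v_iff_of_inChain hk hlj d).2 ⟨hj, hdc.symm, Or.inl hdb.symm⟩⟩,
          c, b, hbc.symm, hk⟩
  rw [key, sum_union]
  · rfl
  · rw [disjoint_left]
    intro k hk hk'
    simp only [mem_filter, mem_univ, true_and] at hk hk'
    exact hbc (A.cone_injective k
      ((A.cone_of_inChain hbc hk).trans (A.cone_of_inChain hbc.symm hk').symm))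

theorem card_Aset (i : Fin r) : ((A.Aset i).card : ℤ) =
    ∑ a, if A.labelsUnder i ⊆ {a} then ((A.children i a).card : ℤ) else 0 := by
  have : A.Aset i =
      (univ.filter fun a => A.labelsUnder i ⊆ {a}).biUnion fun a => A.children i a := by
    ext k
    simp only [Aset, mem_filter, mem_univ, true_and, mem_biUnion, IsChild, A.prox_iff]
    constructor
    · rintro ⟨⟨hk, hp⟩, h⟩
      have hc : k ∈ A.children i (A.label k) := mem_children.2 ⟨hk, hp, rfl⟩
      refine ⟨A.label k, fun d hd => mem_singleton.2 ?_, hc⟩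
      obtain ⟨l, hl⟩ := (A.mem_labelsUnder_iff i d).1 hd
      by_contra hne
      exact h ⟨l, ⟨d, hl⟩, d, (A.cone_child_iff hc).2 (Or.inr ⟨hne, hl⟩)⟩
    · rintro ⟨a, ha, hc⟩
      refine ⟨⟨(mem_children.1 hc).1, (mem_children.1 hc).2.1⟩, ?_⟩
      rintro ⟨l, ⟨d, hd⟩, e, he⟩
      have hda := mem_singleton.1 (ha ((A.mem_labelsUnder_iff i d).2 ⟨l, hd⟩))
      have hli := A.lt_of_cone_eq_v hd
      rcases (A.cone_child_iff hc).1 he with h | h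
      · rw [h.2] at hli; exact lt_irrefl _ hli
      · exact h.1 ((A.cone_injective i (h.2.trans hd.symm)).trans hda)
  rw [this, card_biUnion, sum_filter]
  · push_cast; rfl
  · intro a _ b _ hne
    rw [Function.onFun, disjoint_left]
    intro k hk hk'
    exact hne ((mem_children.1 hk).2.2.symm.trans (mem_children.1 hk').2.2)

/-- The squares of the weights of the nodes proximate to `i` along the edge labelled `a`. -/
noncomputable def cornerSq (i : Fin r) (a : Fin 3) : ℤ :=
  A.branchSum {a}ᶜ (fun j => A.m j ^ 2) i a

theorem chi_eq (i : Fin r) : A.chi i = A.m i ^ 2 - ∑ a, A.cornerSq i a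
    - (∑ a, if a ∈ A.labelsUnder i then 0 else A.rab i (a + 1) (a + 2))
    + 3 - (∑ a, if A.labelsUnder i ⊆ {a} then ((A.children i a).card : ℤ) else 0)
    - 2 * ((A.labelsUnder i).card : ℤ) + (((A.labelsUnder i).card.choose 2 : ℕ) : ℤ) := by
  have hne : ∀ a : Fin 3, a ≠ a + 1 ∧ a ≠ a + 2 ∧ a + 1 ≠ a + 2 ∧ ({a}ᶜ : Finset (Fin 3)) =
    {a + 1, a + 2} := by decide
  have hcone : ∀ (g : Fin r → ℤ) a,
      ∑ k with A.cone k a = A.v i, g k = A.branchSum {a}ᶜ g i a := fun g a =>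
    A.sum_eq_branchSum _ g i a _ fun k => by
      rw [mem_filter, A.cone_eq_v_iff_exists_child]; simp
  have h1 : ∑ j ∈ A.proxSet i, A.m j * (A.m j - 1) =
      ∑ a, (A.cornerSq i a - A.branchSum {a}ᶜ A.m i a) := by
    rw [sum_proxSet]
    refine sum_congr rfl fun a _ => ?_
    rw [cornerSq, ← hcone, ← hcone, ← sum_sub_distrib]
    exact sum_congr rfl fun k _ => by ring
  have h2 : ∑ j ∈ A.proxSet i, (A.m j - ∑ k ∈ (A.proxSet i).filter
          (fun k => LinProx A.toToricConstellation k j), A.m k) =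
      ∑ a, (A.M i a (a + 1) + A.M i a (a + 2) - A.branchSum {a}ᶜ A.m i a) := by
    rw [sum_proxSet]
    refine sum_congr rfl fun a _ => ?_
    obtain ⟨n1, n2, n3, n4⟩ := hne a
    rw [n4, ← branchSum_slack A n3, ← n4, ← hcone]
    refine sum_congr rfl fun k hk => ?_
    rw [mem_filter] at hk
    rw [A.sum_linProx hk.2 n1 n2 n3]
  have h3 : ∑ j ∈ A.Bset i, (A.m i - ∑ k ∈ (A.proxSet j).filter
          (fun k => LinProx A.toToricConstellation k i), A.m k) =
      ∑ a, if a ∈ A.labelsUnder i then A.rab i (a + 1) (a + 2) else 0 := by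
    rw [sum_Bset]
    refine sum_congr rfl fun a _ => ?_
    obtain ⟨n1, n2, n3, n4⟩ := hne a
    rw [← sum_cone_eq_v]
    refine sum_congr rfl fun k hk => ?_
    rw [mem_filter] at hk
    rw [A.sum_linProx hk.2 n1 n2 n3, rab]
    ring
  have h4 : ∀ a : Fin 3, (if a ∈ A.labelsUnder i then A.rab i (a + 1) (a + 2) else 0) =
      A.rab i (a + 1) (a + 2) - if a ∈ A.labelsUnder i then 0 else A.rab i (a + 1) (a + 2) := by
    intro a; split_ifs <;> ring
  have h5 : ∑ a : Fin 3, A.rab i (a + 1) (a + 2) =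
      3 * A.m i - ∑ a, (A.M i a (a + 1) + A.M i a (a + 2)) := by
    simp only [rab, Fin.sum_univ_three, Fin.isValue, Fin.reduceAdd, zero_add]
    ring
  rw [chi, h1, h2, h3, card_Bset, card_Aset, sum_congr rfl fun a _ => h4 a, sum_sub_distrib,
    sum_sub_distrib, sum_sub_distrib, h5]
  ring

end ToricCluster

/-- Numerical constraints on a corner of the Newton polygon of a node of weight `m`: `c` counts the
children at the corner, `n` is the weight of the child, `q` the area and `x`, `y` the legs of the
region cut off. -/
def CornerBound (m c n q x y : ℤ) : Prop :=
  (c = 0 ∧ n = 0 ∧ q = 0 ∧ x = 0 ∧ y = 0) ∨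
    (c = 1 ∧ 1 ≤ n ∧ n ≤ x ∧ n ≤ y ∧ q ≤ x * y ∧ (x = m → y = m → q ≤ m * n))

namespace CornerBound

variable {m c n q x y c₁ n₁ q₁ c₂ n₂ q₂ c₃ n₃ q₃ x x' y y' z z' : ℤ}

theorem nonneg (h : CornerBound m c n q x y) : 0 ≤ x ∧ 0 ≤ y ∧ q ≤ x * y := by
  rcases h with ⟨rfl, rfl, rfl, rfl, rfl⟩ | ⟨_, h1, h2, h3, h4, _⟩
  · simp
  · exact ⟨by linarith, by linarith, h4⟩

/-- If the legs have maximal length, then the area missing is at least `m`, unless the child has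
maximal weight. -/
theorem le_of_lt (hm : 0 < m) (h : CornerBound m c n q x y) (hn : n < m) (hx : x ≤ m) (hy : y ≤ m) :
    q ≤ m * (m - 1) := by
  obtain ⟨h0, h0', hq⟩ := h.nonneg
  by_cases hxm : x = m
  · by_cases hym : y = m
    · rcases h with ⟨rfl, rfl, rfl, rfl, rfl⟩ | ⟨_, h1, h2, h3, h4, h5⟩
      · nlinarith
      · nlinarith [h5 hxm hym]
    · have : y ≤ m - 1 := by omega
      nlinarith
  · have : x ≤ m - 1 := by omega
    nlinarith

/-- Three disjoint rectangles at the corners of a triangle. -/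
theorem area_le (hx0 : 0 ≤ x) (hx0' : 0 ≤ x') (hy0 : 0 ≤ y) (hy0' : 0 ≤ y') (hz0 : 0 ≤ z)
    (hz0' : 0 ≤ z') (hx : x + x' ≤ m) (hy : y + y' ≤ m) (hz : z + z' ≤ m) :
    x * y + x' * z + y' * z' ≤ m ^ 2 := by
  have e1 : x' * z ≤ (m - x) * z := mul_le_mul_of_nonneg_right (by linarith) hz0
  have e2 : y' * z' ≤ (m - y) * (m - z) :=
    mul_le_mul (by linarith) (by linarith) hz0' (by linarith)
  rcases le_total y x with h | h
  · nlinarith [mul_nonneg hy0 (by linarith : 0 ≤ m - x), mul_nonneg hz0 (sub_nonneg.2 h)]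
  · nlinarith [mul_nonneg hx0 (by linarith : 0 ≤ m - y),
      mul_nonneg (by linarith : 0 ≤ m - z) (sub_nonneg.2 h)]

/-- Three exceptional sides. -/
theorem area_nonneg (h₁ : CornerBound m c₁ n₁ q₁ x y) (h₂ : CornerBound m c₂ n₂ q₂ x' z)
    (h₃ : CornerBound m c₃ n₃ q₃ y' z') (hx : x + x' ≤ m) (hy : y + y' ≤ m)
    (hz : z + z' ≤ m) : 0 ≤ m ^ 2 - q₁ - q₂ - q₃ := by
  obtain ⟨hx0, hy0, hq₁⟩ := h₁.nonneg
  obtain ⟨hx0', hz0, hq₂⟩ := h₂.nonneg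
  obtain ⟨hy0', hz0', hq₃⟩ := h₃.nonneg
  linarith [area_le hx0 hx0' hy0 hy0' hz0 hz0' hx hy hz]

/-- Two exceptional sides: the Euler characteristic is nonnegative unless the third corner is
entirely cut off. -/
theorem chi_two (hm : 0 < m) (h₁ : CornerBound m c₁ n₁ q₁ x y) (h₂ : CornerBound m c₂ n₂ q₂ x' z)
    (h₃ : CornerBound m c₃ n₃ q₃ y' z') (hx : x + x' ≤ m) (hy : y + y' ≤ m)
    (hz : z + z' ≤ m) (h : m ^ 2 - q₁ - q₂ - q₃ - (m - x - x') < 0) : m ≤ n₃ := by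
  obtain ⟨hx0, hy0, hq₁⟩ := h₁.nonneg
  obtain ⟨hx0', hz0, hq₂⟩ := h₂.nonneg
  obtain ⟨hy0', hz0', hq₃⟩ := h₃.nonneg
  obtain ⟨u, hu⟩ : ∃ u, u = m - y' := ⟨_, rfl⟩
  obtain ⟨w, hw⟩ : ∃ w, w = m - z' := ⟨_, rfl⟩
  obtain ⟨s, hs⟩ : ∃ s, s = m - x - x' := ⟨_, rfl⟩
  have hyu : y ≤ u := by linarith
  have hzw : z ≤ w := by linarith
  have hu0 : 0 ≤ u := hy0.trans hyu
  have hw0 : 0 ≤ w := hz0.trans hzw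
  have hs0 : 0 ≤ s := by linarith
  have e1 : x * y ≤ x * u := mul_le_mul_of_nonneg_left hyu hx0
  have e2 : x' * z ≤ x' * w := mul_le_mul_of_nonneg_left hzw hx0'
  obtain rfl : y' = m - u := by linarith
  obtain rfl : z' = m - w := by linarith
  obtain rfl : m = s + x + x' := by linarith
  have key : s * (u + w) + u * x' + w * x - u * w < s := by nlinarith
  have hu1 : u ≤ s + x + x' := by linarith
  have hw1 : w ≤ s + x + x' := by linarith
  have huw : u = 0 ∧ w = 0 := by
    rcases hu0.eq_or_lt with h0 | h0
    · refine ⟨h0.symm, ?_⟩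
      subst h0
      by_contra hne
      have : 1 ≤ w := by omega
      nlinarith [mul_nonneg hw0 hx0]
    · exfalso
      rcases hw0.eq_or_lt with h1 | h1
      · subst h1
        nlinarith [mul_nonneg hu0 hx0']
      · have hu2 : 1 ≤ u := h0
        have hw2 : 1 ≤ w := h1
        rcases le_total w (s + x') with h2 | h2
        · nlinarith [mul_nonneg (sub_nonneg.2 hu2) (sub_nonneg.2 h2), mul_nonneg hw0 hx0,
            mul_nonneg hs0 (sub_nonneg.2 hw2)]
        · by_cases hsx : s + x = 0
          · obtain rfl : s = 0 := by linarith
            obtain rfl : x = 0 := by linarith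
            nlinarith
          · have hsx1 : 1 ≤ s + x := by omega
            nlinarith [mul_nonneg (sub_nonneg.2 hu1) (sub_nonneg.2 h2),
              mul_nonneg (sub_nonneg.2 hw2) (sub_nonneg.2 hsx1)]
  obtain ⟨rfl, rfl⟩ := huw
  obtain rfl : y = 0 := by linarith
  obtain rfl : z = 0 := by linarith
  by_contra hn
  have := h₃.le_of_lt hm (by linarith) (by linarith) (by linarith)
  nlinarith

/-- One exceptional side. -/
theorem chi_one (hm : 0 < m) (h₁ : CornerBound m c₁ n₁ q₁ x y) (h₂ : CornerBound m c₂ n₂ q₂ x' z)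
    (h₃ : CornerBound m c₃ n₃ q₃ y' z') (hx : x + x' ≤ m) (hy : y + y' ≤ m) (hz : z + z' ≤ m)
    (h : m ^ 2 - q₁ - q₂ - q₃ - (m - x - x') - (m - y - y') + 1 - c₁ < 0) :
    m ≤ n₂ ∨ m ≤ n₃ := by
  by_contra! hn
  obtain ⟨hn₂, hn₃⟩ := hn
  obtain ⟨hx0, hy0, hq₁⟩ := h₁.nonneg
  obtain ⟨hx0', hz0, hq₂⟩ := h₂.nonneg
  obtain ⟨hy0', hz0', hq₃⟩ := h₃.nonneg
  rcases h₁ with ⟨rfl, rfl, rfl, rfl, rfl⟩ | ⟨rfl, h1, h2, h3, h4, _⟩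
  · have single : ∀ {c n q y' z' : ℤ}, CornerBound m c n q y' z' → n < m → 0 ≤ y' → 0 ≤ z' →
        y' ≤ m → z' ≤ m → q ≤ y' * z' → 0 ≤ m ^ 2 - q - 2 * m + y' + 1 := by
      intro c n q y' z' hc hn hy0 hz0 hy hz hq
      by_cases hz' : z' = m
      · by_cases hy' : y' = m
        · have := hc.le_of_lt hm hn hy hz
          nlinarith
        · have : y' ≤ m - 1 := by omega
          subst hz'
          nlinarith
      · rcases hz0.eq_or_lt with h0 | h0
        · subst h0
          nlinarith [sq_nonneg (m - 1)]
        · have : z' ≤ m - 1 := by omega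
          nlinarith [mul_nonneg (sub_nonneg.2 hy) (by linarith : 0 ≤ z' - 1),
            mul_nonneg hm.le (by linarith : 0 ≤ m - 1 - z')]
    rcases h₂ with ⟨rfl, rfl, rfl, rfl, rfl⟩ | ⟨_, a1, a2, a3, a4, _⟩
    · have := single h₃ hn₃ hy0' hz0' (by linarith) (by linarith) hq₃
      linarith
    · rcases h₃ with ⟨rfl, rfl, rfl, rfl, rfl⟩ | ⟨_, b1, b2, b3, b4, _⟩
      · have := single (Or.inr ⟨rfl, a1, a2, a3, a4, ‹_›⟩) hn₂ hx0' hz0 (by linarith)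
          (by linarith) hq₂
        linarith
      · have e1 : x' * (z - 1) ≤ m * (z - 1) :=
          mul_le_mul_of_nonneg_right (by linarith) (by linarith)
        have e2 : y' * (z' - 1) ≤ m * (z' - 1) :=
          mul_le_mul_of_nonneg_right (by linarith) (by linarith)
        nlinarith
  · have e0 : ∀ {x x' y y' z z' : ℤ}, x + x' ≤ m → y + y' ≤ m → z + z' ≤ m → 1 ≤ x → 1 ≤ y →
        0 ≤ x' → 0 ≤ y' → 0 ≤ z → 0 ≤ z' → y' ≤ x' →
        (m - x - x') + (m - y - y') ≤ m ^ 2 - x * y - x' * z - y' * z' := by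
      intro x x' y y' z z' hx hy hz hx1 hy1 hx0 hy0 hz0 hz0' hyx
      have e1 : y' * z' ≤ x' * z' := mul_le_mul_of_nonneg_right hyx hz0'
      have e2 : x' * (z + z') ≤ x' * m := mul_le_mul_of_nonneg_left hz hx0
      have e3 : 0 ≤ (m - x - x') * (m - 1) := mul_nonneg (by linarith) (by linarith)
      have e4 : 0 ≤ (x - 1) * (m - y - y') := mul_nonneg (by linarith) (by linarith)
      have e5 : 0 ≤ x * y' := mul_nonneg (by linarith) hy0
      nlinarith
    rcases le_total y' x' with hle | hle
    · have := e0 hx hy hz (by linarith) (by linarith) hx0' hy0' hz0 hz0' hle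
      linarith
    · have := e0 hy hx (by linarith : z' + z ≤ m) (by linarith) (by linarith) hy0' hx0' hz0' hz0 hle
      linarith [mul_comm x y]

/-- A single child, on a polygon all of whose sides count. -/
theorem chi_zero_single (hm : 0 < m) (h : CornerBound m c n q x y) (hx : x ≤ m) (hy : y ≤ m)
    (hn : n < m) : 0 < m ^ 2 - q - (m - x) - (m - y) - m + 3 - c := by
  obtain ⟨hx0, hy0, hq⟩ := h.nonneg
  have hq' := h.le_of_lt hm hn hx hy
  rcases h with ⟨rfl, rfl, rfl, rfl, rfl⟩ | ⟨rfl, h1, h2, h3, h4, _⟩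
  · nlinarith [sq_nonneg (m - 2)]
  · have key : ∀ {x y : ℤ}, q ≤ x * y → 1 ≤ x → x ≤ m → 1 ≤ y → y ≤ m - 1 →
        0 < m ^ 2 - q - (m - x) - (m - y) - m + 3 - 1 := by
      intro x y hq hx1 hx hy1 hy
      nlinarith [mul_nonneg (sub_nonneg.2 hx) (sub_nonneg.2 hy1),
        mul_nonneg (by linarith : 0 ≤ m - 1) (sub_nonneg.2 hy)]
    by_cases hym : y = m
    · by_cases hxm : x = m
      · subst hym; subst hxm; nlinarith
      · have := key (x := y) (y := x) (by linarith [mul_comm x y]) (by linarith) hy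
          (by linarith) (by omega)
        linarith
    · exact key hq (by linarith) hx (by linarith) (by omega)

/-- Two children, on a polygon all of whose sides count. -/
theorem chi_zero_pair (hx0 : 1 ≤ x) (hx0' : 1 ≤ x') (hq₁ : q₁ ≤ x * y)
    (hq₂ : q₂ ≤ x' * z) (hx : x + x' ≤ m) (hy : y ≤ m) (hz : z ≤ m) :
    0 < m ^ 2 - q₁ - q₂ - (m - x - x') - (m - y) - (m - z) + 3 - 2 := by
  nlinarith [mul_nonneg (sub_nonneg.2 hx0) (sub_nonneg.2 hy),
    mul_nonneg (sub_nonneg.2 hx0') (sub_nonneg.2 hz),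
    mul_nonneg (by linarith : 0 ≤ m - 1) (sub_nonneg.2 hx)]

/-- No exceptional sides. -/
theorem chi_zero (hm : 0 < m) (h₁ : CornerBound m c₁ n₁ q₁ x y)
    (h₂ : CornerBound m c₂ n₂ q₂ x' z)
    (h₃ : CornerBound m c₃ n₃ q₃ y' z') (hx : x + x' ≤ m) (hy : y + y' ≤ m) (hz : z + z' ≤ m)
    (h : m ^ 2 - q₁ - q₂ - q₃ - (m - x - x') - (m - y - y') - (m - z - z')
      + 3 - c₁ - c₂ - c₃ < 0) :
    m ≤ n₁ ∨ m ≤ n₂ ∨ m ≤ n₃ := by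
  by_contra! hn
  obtain ⟨hn₁, hn₂, hn₃⟩ := hn
  have H₁ := h₁
  have H₂ := h₂
  have H₃ := h₃
  rcases h₁ with ⟨rfl, rfl, rfl, rfl, rfl⟩ | ⟨rfl, a1, a2, a3, a4, _⟩ <;>
  rcases h₂ with ⟨rfl, rfl, rfl, rfl, rfl⟩ | ⟨rfl, b1, b2, b3, b4, _⟩ <;>
  rcases h₃ with ⟨rfl, rfl, rfl, rfl, rfl⟩ | ⟨rfl, d1, d2, d3, d4, _⟩
  · nlinarith [sq_nonneg (m - 2)]
  · have := H₃.chi_zero_single hm (by linarith) (by linarith) hn₃; linarith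
  · have := H₂.chi_zero_single hm (by linarith) (by linarith) hn₂; linarith
  · have := chi_zero_pair (m := m) (q₁ := q₂) (q₂ := q₃) (x := z) (y := x') (x' := z') (z := y')
      (by linarith) (by linarith) (by linarith [mul_comm x' z])
      (by linarith [mul_comm y' z']) (by linarith) (by linarith) (by linarith)
    linarith
  · have := H₁.chi_zero_single hm (by linarith) (by linarith) hn₁; linarith
  · have := chi_zero_pair (m := m) (q₁ := q₁) (q₂ := q₃) (x := y) (y := x) (x' := y') (z := z')
      (by linarith) (by linarith) (by linarith [mul_comm x y])
      (by linarith) (by linarith) (by linarith) (by linarith)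
    linarith
  · have := chi_zero_pair (m := m) (q₁ := q₁) (q₂ := q₂) (x := x) (y := y) (x' := x') (z := z)
      (by linarith) (by linarith) (by linarith)
      (by linarith) (by linarith) (by linarith) (by linarith)
    linarith
  · have := area_le (m := m - 2) (x := x - 1) (x' := x' - 1) (y := y - 1) (y' := y' - 1)
      (z := z - 1) (z' := z' - 1) (by linarith) (by linarith) (by linarith) (by linarith)
      (by linarith) (by linarith) (by linarith) (by linarith) (by linarith)
    linarith

end CornerBound

namespace ToricCluster

open ToricConstellation

variable {r : ℕ} (A : ToricCluster r) {i : Fin r} {a b c : Fin 3}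

/-- The weight of the child along the edge labelled `a`, or `0` if there is none. -/
noncomputable def childWeight (i : Fin r) (a : Fin 3) : ℤ :=
  ∑ k ∈ A.children i a, A.m k

theorem sum_fin_three_of_ne (hab : a ≠ b) (hac : a ≠ c) (hbc : b ≠ c) (f : Fin 3 → ℤ) :
    ∑ d, f d = f a + f b + f c := by
  have : (univ : Finset (Fin 3)) = {a, b, c} := by
    clear f
    revert a b c
    decide
  rw [this, sum_insert (by simp [hab, hac]), sum_pair hbc, add_assoc]

theorem rab_comm (i : Fin r) (a b : Fin 3) : A.rab i a b = A.rab i b a := by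
  unfold rab; ring

theorem rab_add_one_add_two (i : Fin r) (hab : a ≠ b) (hac : a ≠ c) (hbc : b ≠ c) :
    A.rab i (a + 1) (a + 2) = A.rab i b c := by
  have : (b = a + 1 ∧ c = a + 2) ∨ (b = a + 2 ∧ c = a + 1) := by
    revert a b c
    decide
  rcases this with ⟨rfl, rfl⟩ | ⟨rfl, rfl⟩
  · rfl
  · exact A.rab_comm _ _ _

theorem chi_eq_of_ne (i : Fin r) (hab : a ≠ b) (hac : a ≠ c) (hbc : b ≠ c) :
    A.chi i = A.m i ^ 2 - A.cornerSq i a - A.cornerSq i b - A.cornerSq i c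
      - (if c ∈ A.labelsUnder i then 0 else A.m i - A.M i a b - A.M i b a)
      - (if b ∈ A.labelsUnder i then 0 else A.m i - A.M i a c - A.M i c a)
      - (if a ∈ A.labelsUnder i then 0 else A.m i - A.M i b c - A.M i c b)
      + 3 - (if A.labelsUnder i ⊆ {a} then ((A.children i a).card : ℤ) else 0)
      - (if A.labelsUnder i ⊆ {b} then ((A.children i b).card : ℤ) else 0)
      - (if A.labelsUnder i ⊆ {c} then ((A.children i c).card : ℤ) else 0)
      - 2 * ((A.labelsUnder i).card : ℤ) + (((A.labelsUnder i).card.choose 2 : ℕ) : ℤ) := by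
  rw [chi_eq, sum_fin_three_of_ne hab hac hbc, sum_fin_three_of_ne hab hac hbc,
    sum_fin_three_of_ne hab hac hbc, A.rab_add_one_add_two i hab hac hbc,
    A.rab_add_one_add_two i hab.symm hbc hac, A.rab_add_one_add_two i hac.symm hbc.symm hab]
  simp only [rab]
  ring

theorem cornerBound (hA : A.Idealistic) (hab : a ≠ b) (hac : a ≠ c) (hbc : b ≠ c) :
    CornerBound (A.m i) (A.children i a).card (A.childWeight i a) (A.cornerSq i a)
      (A.M i a b) (A.M i a c) := by
  have hcompl : ({a}ᶜ : Finset (Fin 3)) = {b, c} := by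
    revert a b c
    decide
  have hx := hA i a b hab
  have hy := hA i a c hac
  have hx' := A.M_nonneg i b a
  have hy' := A.M_nonneg i c a
  rw [cornerSq, hcompl, childWeight, M_eq_branchSum, M_eq_branchSum] at *
  rcases A.children_eq_empty_or_singleton i a with h | ⟨k, h⟩
  · left
    simp [A.branchSum_of_eq_empty h, h]
  · right
    simp only [A.branchSum_of_eq_singleton h, h, sum_singleton, card_singleton, Nat.cast_one,
      true_and] at *
    have hk := A.m_pos k
    have h1 := A.le_reachSum {b} k
    have h2 := A.le_reachSum {c} k
    have h3 := A.corner_bound hA hbc k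
    have h4 := mul_nonneg (sub_nonneg.2 h1) (sub_nonneg.2 h2)
    have h5 := mul_nonneg hk.le (le_min (sub_nonneg.2 h1) (sub_nonneg.2 h2))
    refine ⟨hk, h1, h2, by linarith, fun e1 e2 => ?_⟩
    rw [e1, e2, min_self] at h3
    nlinarith

theorem childWeight_le (hA : A.Idealistic) : A.childWeight i a ≤ A.m i := by
  obtain ⟨b, c, hab, hac, hbc⟩ : ∃ b c : Fin 3, a ≠ b ∧ a ≠ c ∧ b ≠ c := by
    revert a
    decide
  have h1 := hA i a b hab
  have h2 := A.M_nonneg i b a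
  rcases A.cornerBound (i := i) hA hab hac hbc with ⟨-, h, -⟩ | ⟨-, -, h, -⟩
  · have := A.m_pos i
    linarith
  · linarith

theorem exists_child_of_le_childWeight (hA : A.Idealistic) (h : A.m i ≤ A.childWeight i a) :
    ∃ k ∈ A.children i a, A.m k = A.m i := by
  have h' := A.childWeight_le (i := i) (a := a) hA
  have hi := A.m_pos i
  rcases A.children_eq_empty_or_singleton i a with hc | ⟨k, hc⟩
  · simp [childWeight, hc] at h
    omega
  · refine ⟨k, by simp [hc], ?_⟩
    simp only [childWeight, hc, sum_singleton] at h h'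
    omega

theorem exists_labels (S : Finset (Fin 3)) : ∃ a b c : Fin 3, a ≠ b ∧ a ≠ c ∧ b ≠ c ∧
    (S = ∅ ∨ S = {a} ∨ S = {a, b} ∨ S = {a, b, c}) := by
  revert S
  decide

theorem not_subset_singleton_of_ne {S : Finset (Fin 3)} (hab : a ≠ b) (ha : a ∈ S) (hb : b ∈ S)
    (d : Fin 3) : ¬ S ⊆ {d} := fun h =>
  hab ((mem_singleton.1 (h ha)).trans (mem_singleton.1 (h hb)).symm)

/-- A node with negative Euler characteristic has a child of the same weight, along an edge with a
new label. -/
theorem exists_child_of_chi_neg (hA : A.Idealistic) (h : A.chi i < 0) :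
    ∃ a ∉ A.labelsUnder i, ∃ k ∈ A.children i a, A.m k = A.m i := by
  obtain ⟨a, b, c, hab, hac, hbc, hS⟩ := exists_labels (A.labelsUnder i)
  have h₁ := A.cornerBound (i := i) hA hab hac hbc
  have h₂ := A.cornerBound (i := i) hA hab.symm hbc hac
  have h₃ := A.cornerBound (i := i) hA hac.symm hbc.symm hab
  have hx := hA i a b hab
  have hy := hA i a c hac
  have hz := hA i b c hbc
  have hm := A.m_pos i
  rw [A.chi_eq_of_ne i hab hac hbc] at h
  rcases hS with hS | hS | hS | hS
  · simp only [hS, notMem_empty, if_false, empty_subset, if_true, card_empty] at h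
    have := CornerBound.chi_zero hm h₁ h₂ h₃ hx hy hz (by simpa using h)
    rw [hS]
    rcases this with h | h | h
    · exact ⟨a, by simp, A.exists_child_of_le_childWeight hA h⟩
    · exact ⟨b, by simp, A.exists_child_of_le_childWeight hA h⟩
    · exact ⟨c, by simp, A.exists_child_of_le_childWeight hA h⟩
  · simp [hS, hab, hac, hab.symm, hac.symm] at h
    have := CornerBound.chi_one hm h₁ h₂ h₃ hx hy hz (by linarith)
    rw [hS]
    rcases this with h | h
    · exact ⟨b, by simp [hab.symm], A.exists_child_of_le_childWeight hA h⟩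
    · exact ⟨c, by simp [hac.symm], A.exists_child_of_le_childWeight hA h⟩
  · have hsub := not_subset_singleton_of_ne (S := {a, b}) hab (by simp) (by simp)
    simp only [hS, hsub, if_false] at h
    simp [hac.symm, hbc.symm, card_pair hab] at h
    have := CornerBound.chi_two hm h₁ h₂ h₃ hx hy hz (by linarith)
    rw [hS]
    exact ⟨c, by simp [hac.symm, hbc.symm], A.exists_child_of_le_childWeight hA this⟩
  · have hsub := not_subset_singleton_of_ne (S := {a, b, c}) hab (by simp) (by simp)
    simp only [hS, hsub, if_false] at h
    simp [hab, hac, hbc] at h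
    have := CornerBound.area_nonneg h₁ h₂ h₃ hx hy hz
    linarith

/-- The Euler characteristic of a node all of whose children are along the edge labelled `a`. -/
theorem chi_of_children_eq_empty (hab : a ≠ b) (hac : a ≠ c) (hbc : b ≠ c)
    (hb : A.children i b = ∅) (hc : A.children i c = ∅) :
    A.chi i = A.m i ^ 2 - A.cornerSq i a
      - (if c ∈ A.labelsUnder i then 0 else A.m i - A.M i a b)
      - (if b ∈ A.labelsUnder i then 0 else A.m i - A.M i a c)
      - (if a ∈ A.labelsUnder i then 0 else A.m i)
      + 3 - (if A.labelsUnder i ⊆ {a} then ((A.children i a).card : ℤ) else 0)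
      - 2 * ((A.labelsUnder i).card : ℤ) + (((A.labelsUnder i).card.choose 2 : ℕ) : ℤ) := by
  rw [A.chi_eq_of_ne i hab hac hbc]
  simp [cornerSq, M_eq_branchSum, A.branchSum_of_eq_empty hb, A.branchSum_of_eq_empty hc, hb, hc]

theorem children_eq_empty_of_M_nonpos (h : A.M i b a ≤ 0) : A.children i b = ∅ := by
  rcases A.children_eq_empty_or_singleton i b with hb | ⟨k, hb⟩
  · exact hb
  · have := A.m_pos k
    have := A.le_reachSum {a} k
    rw [M_eq_branchSum, A.branchSum_of_eq_singleton hb] at h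
    linarith

/-- Lower bound for the Euler characteristic of a node with a child of the same weight. -/
theorem le_chi_of_child (hA : A.Idealistic) (ha : a ∉ A.labelsUnder i) {k : Fin r}
    (hk : k ∈ A.children i a) (hm : A.m k = A.m i) :
    2 - ((A.labelsUnder i).card : ℤ) - A.m i ≤ A.chi i := by
  obtain ⟨b, c, hab, hac, hbc, hS⟩ : ∃ b c : Fin 3, a ≠ b ∧ a ≠ c ∧ b ≠ c ∧
      (A.labelsUnder i = ∅ ∨ A.labelsUnder i = {b} ∨ A.labelsUnder i = {b, c}) := by
    generalize A.labelsUnder i = S at ha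
    clear * - ha
    revert a S
    decide
  have hsingle : A.children i a = {k} := by
    rcases A.children_eq_empty_or_singleton i a with h | ⟨l, h⟩
    · simp [h] at hk
    · rw [h, mem_singleton] at hk
      rw [h, hk]
  have hx := hA i a b hab
  have hy := hA i a c hac
  have hx0 := A.M_nonneg i b a
  have hy0 := A.M_nonneg i c a
  have hx1 : A.m i ≤ A.M i a b := by
    rw [M_eq_branchSum, A.branchSum_of_eq_singleton hsingle, ← hm]
    exact A.le_reachSum _ _
  have hy1 : A.m i ≤ A.M i a c := by
    rw [M_eq_branchSum, A.branchSum_of_eq_singleton hsingle, ← hm]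
    exact A.le_reachSum _ _
  have hq : A.cornerSq i a ≤ A.m i ^ 2 := by
    have := (A.cornerBound (i := i) hA hab hac hbc).nonneg.2.2
    rwa [le_antisymm (by linarith : A.M i a b ≤ A.m i) hx1,
      le_antisymm (by linarith : A.M i a c ≤ A.m i) hy1, ← sq] at this
  rw [A.chi_of_children_eq_empty hab hac hbc
    (A.children_eq_empty_of_M_nonpos (a := a) (by linarith))
    (A.children_eq_empty_of_M_nonpos (a := a) (by linarith))]
  rcases hS with hS | hS | hS
  · simp [hS, hsingle]
    linarith
  · simp [hS, hab, hbc.symm, hab.symm]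
    linarith
  · have hsub := not_subset_singleton_of_ne (S := {b, c}) hbc (by simp) (by simp)
    simp only [hS, hsub, if_false]
    simp [hab, hac, card_pair hbc]
    linarith

/-- Lower bound for the Euler characteristic of a node all of whose children are along an edge with
an old label, and are of smaller weight. -/
theorem le_chi_of_childWeight_lt (hA : A.Idealistic) (ha : a ∈ A.labelsUnder i)
    (hempty : ∀ b, b ≠ a → A.children i b = ∅) (hn : A.childWeight i a < A.m i) :
    A.m i - 3 + ((A.labelsUnder i).card : ℤ) ≤ A.chi i := by
  obtain ⟨b, c, hab, hac, hbc, hS⟩ : ∃ b c : Fin 3, a ≠ b ∧ a ≠ c ∧ b ≠ c ∧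
      (A.labelsUnder i = {a} ∨ A.labelsUnder i = {a, b} ∨ A.labelsUnder i = {a, b, c}) := by
    generalize A.labelsUnder i = S at ha
    clear * - ha
    revert a S
    decide
  have hx := hA i a b hab
  have hy := hA i a c hac
  have hx0 := A.M_nonneg i b a
  have hy0 := A.M_nonneg i c a
  have hm := A.m_pos i
  have hcb := A.cornerBound (i := i) hA hab hac hbc
  have hq := hcb.le_of_lt hm hn (by linarith) (by linarith)
  rw [A.chi_of_children_eq_empty hab hac hbc (hempty b hab.symm) (hempty c hac.symm)]
  rcases hS with hS | hS | hS
  · have := hcb.chi_zero_single hm (by linarith) (by linarith) hn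
    simp [hS, hab.symm, hac.symm]
    linarith
  · have hsub := not_subset_singleton_of_ne (S := {a, b}) hab (by simp) (by simp)
    simp only [hS, hsub, if_false]
    simp [hac.symm, hbc.symm, card_pair hab]
    obtain ⟨h1, h2, h3⟩ := hcb.nonneg
    by_cases hxm : A.M i a b = A.m i
    · nlinarith
    · have : A.M i a b ≤ A.m i - 1 := by omega
      nlinarith
  · have hsub := not_subset_singleton_of_ne (S := {a, b, c}) hab (by simp) (by simp)
    simp only [hS, hsub, if_false]
    simp [hab, hac, hbc]
    nlinarith

end ToricCluster

namespace ToricCluster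

open ToricConstellation

variable {r : ℕ} (A : ToricCluster r)

theorem anteSet_eq_Bset (i : Fin r) : A.anteSet i = A.Bset i := by
  ext l
  simp only [anteSet, Bset, mem_filter, mem_univ, true_and, and_iff_right_iff_imp]
  rintro ⟨-, d, hd⟩
  exact A.lt_of_cone_eq_v hd

theorem N_eq (i : Fin r) : A.N i = A.m i + ∑ d, ∑ l with A.cone i d = A.v l, A.N l := by
  rw [N, sum_attach (A.anteSet i) A.N, anteSet_eq_Bset, sum_Bset]

theorem nu_eq (i : Fin r) :
    A.nu i = 3 + ∑ d, ∑ l with A.cone i d = A.v l, (A.nu l - 1) := by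
  rw [nu, sum_attach (A.anteSet i) fun l => A.nu l - 1, anteSet_eq_Bset, sum_Bset]

/-- `A.EqChain i a t w` states that `w` is reached from `i` by `t` edges labelled `a`, all through
nodes of the same weight. -/
inductive EqChain (i : Fin r) (a : Fin 3) : ℕ → Fin r → Prop
  | base : EqChain i a 0 i
  | step {t : ℕ} {w k : Fin r} (h : EqChain i a t w) (hk : k ∈ A.children w a)
      (hm : A.m k = A.m i) : EqChain i a (t + 1) k

namespace EqChain

variable {A} {i i' w k : Fin r} {a a' d : Fin 3} {t t' : ℕ}

theorem m_eq (h : A.EqChain i a t w) : A.m w = A.m i := by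
  cases h <;> simp_all

theorem labelsUnder_eq (h : A.EqChain i a (t + 1) w) :
    A.labelsUnder w = insert a (A.labelsUnder i) := by
  induction t generalizing w with
  | zero =>
    rcases h with _ | ⟨h, hk, -⟩
    cases h
    exact A.labelsUnder_child hk
  | succ t ih =>
    rcases h with _ | ⟨h, hk, -⟩
    rw [A.labelsUnder_child hk, ih h, insert_idem]

theorem cone_iff (h : A.EqChain i a t w) (hd : d ≠ a) (l : Fin r) :
    A.cone w d = A.v l ↔ A.cone i d = A.v l := by
  induction h with
  | base => rfl
  | step h hk _ ih => rw [A.cone_child_iff hk, ← ih]; simp [hd]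

theorem sum_step (h : A.EqChain i a t w) (hk : k ∈ A.children w a) (ha : a ∉ A.labelsUnder i)
    (g : Fin r → ℤ) : ∑ d, ∑ l with A.cone k d = A.v l, g l =
      g w + ∑ d, ∑ l with A.cone i d = A.v l, g l := by
  rw [← add_sum_erase _ _ (mem_univ a), ← add_sum_erase univ _ (mem_univ a)]
  have h1 : (univ.filter fun l => A.cone k a = A.v l) = {w} := by
    ext l
    simp [A.cone_child_iff hk]
  have h2 : (univ.filter fun l => A.cone i a = A.v l) = ∅ := by
    rw [A.mem_labelsUnder_iff, not_exists] at ha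
    exact filter_false_of_mem fun l _ => ha l
  rw [h1, h2, sum_singleton, sum_empty, zero_add]
  congr 1
  refine sum_congr rfl fun d hd => ?_
  have hda := ne_of_mem_erase hd
  congr 1
  ext l
  simp [A.cone_child_iff hk, hda, h.cone_iff hda]

theorem N_eq (h : A.EqChain i a t w) (ha : a ∉ A.labelsUnder i) :
    A.N w = (t + 1) * A.N i := by
  induction h with
  | base => simp
  | step h hk hm ih =>
    have := A.N_eq i
    rw [A.N_eq, h.sum_step hk ha, ih, hm]
    push_cast
    linarith

theorem nu_eq (h : A.EqChain i a t w) (ha : a ∉ A.labelsUnder i) :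
    A.nu w = 1 + (t + 1) * (A.nu i - 1) := by
  induction h with
  | base => simp
  | step h hk hm ih =>
    have := A.nu_eq i
    rw [A.nu_eq, h.sum_step hk ha (fun l => A.nu l - 1), ih]
    push_cast
    linarith

theorem exists_end (h : A.EqChain i a t w) :
    ∃ t' w', A.EqChain i a t' w' ∧ ∀ k ∈ A.children w' a, A.m k ≠ A.m i := by
  induction w using A.children_induction generalizing t with | _ w ih
  by_cases hw : ∀ k ∈ A.children w a, A.m k ≠ A.m i
  · exact ⟨t, w, h, hw⟩
  · push Not at hw
    obtain ⟨k, hk, hm⟩ := hw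
    rcases A.children_eq_empty_or_singleton w a with he | ⟨l, he⟩
    · simp [he] at hk
    · obtain rfl : k = l := by simpa [he] using hk
      exact ih a k he (h.step hk hm)

theorem start_unique (h : A.EqChain i a t w) (h' : A.EqChain i' a t' w)
    (ha : a ∉ A.labelsUnder i) (ha' : a ∉ A.labelsUnder i') : i = i' := by
  induction h generalizing t' with
  | base =>
    cases t' with
    | zero => cases h'; rfl
    | succ t' =>
      rw [h'.labelsUnder_eq] at ha
      simp at ha
  | step h hk hm ih =>
    cases t' with
    | zero =>
      cases h'
      rw [(h.step hk hm).labelsUnder_eq] at ha'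
      simp at ha'
    | succ t' =>
      rcases h' with _ | ⟨h', hk', -⟩
      obtain rfl := (mem_children.1 hk).2.1.symm.trans (mem_children.1 hk').2.1
      exact ih h'

theorem label_eq (h : A.EqChain i a (t + 1) w) : A.label w = a := by
  rcases h with _ | ⟨-, hk, -⟩
  exact (mem_children.1 hk).2.2

theorem children_eq_empty (hA : A.Idealistic) (h : A.EqChain i a (t + 1) w) (hd : d ≠ a) :
    A.children w d = ∅ := by
  have hm := h.m_eq
  rcases h with _ | @⟨_, p, _, h, hk, -⟩
  have hp := hA p a d hd.symm
  have hp' := A.M_nonneg p d a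
  have hs : A.children p a = {w} := by
    rcases A.children_eq_empty_or_singleton p a with he | ⟨l, he⟩
    · simp [he] at hk
    · rw [he, mem_singleton] at hk
      rw [he, hk]
  rw [M_eq_branchSum, A.branchSum_of_eq_singleton hs, A.reachSum_eq, sum_singleton, hm,
    h.m_eq, ← M_eq_branchSum] at hp
  exact A.children_eq_empty_of_M_nonpos (a := d) (by linarith)

end EqChain

/-- Every node with negative Euler characteristic is compensated by the end of a chain. -/
theorem exists_eqChain_of_chi_neg (hA : A.Idealistic) {i : Fin r} (h : A.chi i < 0) :
    ∃ w t a, a ∉ A.labelsUnder i ∧ A.EqChain i a (t + 1) w ∧ 0 ≤ A.chi i + A.chi w := by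
  obtain ⟨a, ha, k, hk, hm⟩ := A.exists_child_of_chi_neg hA h
  obtain ⟨t, w, hc, hend⟩ := (EqChain.base (A := A) (i := i) (a := a)).exists_end
  cases t with
  | zero =>
    cases hc
    exact absurd hm (hend k hk)
  | succ t =>
    refine ⟨w, t, a, ha, hc, ?_⟩
    have hi := A.le_chi_of_child hA ha hk hm
    have hlt : A.childWeight w a < A.m w := by
      by_contra! hle
      obtain ⟨l, hl, hlm⟩ := A.exists_child_of_le_childWeight hA hle
      exact hend l hl (hlm.trans hc.m_eq)
    have hw := A.le_chi_of_childWeight_lt hA (a := a) (by simp [hc.labelsUnder_eq])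
      (fun b hb => hc.children_eq_empty hA hb) hlt
    rw [hc.labelsUnder_eq, card_insert_of_notMem ha, hc.m_eq] at hw
    push_cast at hw
    linarith

end ToricCluster

theorem Finset.sum_pos_of_injOn_compensation {ι : Type*} [DecidableEq ι] {s : Finset ι}
    {χ : ι → ℤ} {j : ι} (hj : j ∈ s) (hpos : 0 < χ j) {f : ι → ι}
    (hf : ∀ i ∈ s, χ i < 0 → f i ∈ s ∧ f i ≠ j ∧ 0 ≤ χ i + χ (f i))
    (hinj : ∀ i i', χ i < 0 → χ i' < 0 → f i = f i' → i = i') : 0 < ∑ i ∈ s, χ i := by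
  have hinj' : Set.InjOn f (s.filter fun i => χ i < 0) := fun i hi i' hi' h =>
    hinj i i' (mem_filter.1 hi).2 (mem_filter.1 hi').2 h
  have hjn : j ∉ (s.filter fun i => χ i < 0).image f := by
    simp only [mem_image, mem_filter, not_exists, not_and, and_imp]
    exact fun i hi hi' => (hf i hi hi').2.1
  have hsub : insert j ((s.filter fun i => χ i < 0).image f) ⊆ s.filter fun i => ¬ χ i < 0 := by
    intro k hk
    rw [mem_insert, mem_image] at hk
    rw [mem_filter]
    rcases hk with rfl | ⟨i, hi, rfl⟩
    · exact ⟨hj, by linarith⟩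
    · rw [mem_filter] at hi
      have := hf i hi.1 hi.2
      exact ⟨this.1, by linarith⟩
  have h1 := sum_le_sum_of_subset_of_nonneg (f := χ) hsub fun k hk _ =>
    not_lt.1 (mem_filter.1 hk).2
  rw [sum_insert hjn, sum_image hinj'] at h1
  have h2 : 0 ≤ ∑ i ∈ s.filter fun i => χ i < 0, (χ i + χ (f i)) := sum_nonneg fun i hi =>
    (hf i (mem_filter.1 hi).1 (mem_filter.1 hi).2).2.2
  rw [sum_add_distrib] at h2
  rw [← sum_filter_add_sum_filter_not s fun i => χ i < 0]
  linarith

open ToricConstellation ToricCluster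

theorem stmt12 {r : ℕ} (A : ToricCluster r) (hA : A.Idealistic) (j : Fin r)
    (hchi : 0 < A.chi j) (a b : ℕ) (ha : 0 < a) (hb : 0 < b) (hab : Nat.Coprime a b)
    (hratio : A.nu j * (b : ℤ) = (a : ℤ) * A.N j) :
    0 < ∑ i ∈ Finset.univ.filter (fun i => (b : ℤ) ∣ A.N i), A.chi i := by
  have hcop : IsCoprime (b : ℤ) (a : ℤ) := Nat.isCoprime_iff_coprime.2 hab.symm
  have key : ∀ i, ∃ w, A.chi i < 0 → ∃ t d, d ∉ A.labelsUnder i ∧ A.EqChain i d (t + 1) w ∧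
      0 ≤ A.chi i + A.chi w := fun i => by
    by_cases h : A.chi i < 0
    · obtain ⟨w, hw⟩ := A.exists_eqChain_of_chi_neg hA h
      exact ⟨w, fun _ => hw⟩
    · exact ⟨i, fun h' => absurd h' h⟩
  choose f hf using key
  refine sum_pos_of_injOn_compensation (f := f) (j := j) ?_ hchi ?_ ?_
  · rw [mem_filter]
    exact ⟨mem_univ _, hcop.dvd_of_dvd_mul_left (hratio ▸ dvd_mul_left _ _)⟩
  · intro i hi hneg
    rw [mem_filter] at hi
    obtain ⟨t, d, hd, hchain, hsum⟩ := hf i hneg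
    have hN := hchain.N_eq hd
    refine ⟨mem_filter.2 ⟨mem_univ _, hN ▸ hi.2.mul_left _⟩, ?_, hsum⟩
    intro hfj
    rw [hfj] at hN hchain
    have hnu := hchain.nu_eq hd
    obtain ⟨e, he⟩ := hi.2
    have hb0 : (b : ℤ) ≠ 0 := by exact_mod_cast hb.ne'
    have h1 : A.nu j = ((t + 1 : ℕ) + 1) * (a * e) := by
      apply mul_right_cancel₀ hb0
      rw [hratio, hN, he]
      ring
    have h2 : ((t + 1 : ℕ) + 1 : ℤ) ∣ 1 := by
      refine ⟨a * e - (A.nu i - 1), ?_⟩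
      linear_combination h1 - hnu
    have := Int.le_of_dvd one_pos h2
    push_cast at this
    omega
  · intro i i' hi hi' h
    obtain ⟨t, d, hd, hchain, -⟩ := hf i hi
    obtain ⟨t', d', hd', hchain', -⟩ := hf i' hi'
    rw [← h] at hchain'
    obtain rfl := hchain.label_eq.symm.trans hchain'.label_eq
    exact hchain.start_unique hchain' hd hd'
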